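/- For n ≥ 1 and 1 ≤ r ≤ s, the maximum of |A| + |B| over all pairs (A, B) of non-empty cross-intersecting families with A ⊆ ([n] choose ≤ r) and B ⊆ ([n] choose ≤ s) equals 1 + ∑_{i=1}^{s} ( C(n,i) − C(n−r,i) ). -/

import Mathlib

open Finset

/-- The number of subsets of size at most `s` of a set of size `n`. -/
def chooseLE (n s : ℕ) : ℕ := ∑ i ∈ range (s + 1), n.choose i

theorem chooseLE_zero_right (n : ℕ) : chooseLE n 0 = 1 := by simp [chooseLE]

theorem chooseLE_zero_left (s : ℕ) : chooseLE 0 s = 1 := by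
  simp [chooseLE, sum_range_succ']

theorem chooseLE_succ_right (n s : ℕ) :
    chooseLE n (s + 1) = chooseLE n s + n.choose (s + 1) := by
  simp [chooseLE, sum_range_succ _ (s + 1)]

theorem chooseLE_succ_succ (n s : ℕ) :
    chooseLE (n + 1) (s + 1) = chooseLE n (s + 1) + chooseLE n s := by
  induction s with
  | zero => simp [chooseLE_succ_right, chooseLE_zero_right]; omega
  | succ s ih =>
    rw [chooseLE_succ_right, ih, chooseLE_succ_right n (s + 1), Nat.choose_succ_succ',
      chooseLE_succ_right n s]
    omega

theorem chooseLE_pos (n s : ℕ) : 0 < chooseLE n s := by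
  cases s with
  | zero => simp [chooseLE_zero_right]
  | succ s => simp [chooseLE, sum_range_succ']

theorem chooseLE_mono_left (s : ℕ) : Monotone fun n => chooseLE n s :=
  fun _ _ h => sum_le_sum fun i _ => Nat.choose_le_choose i h

theorem chooseLE_lt_of_lt {n n' s : ℕ} (h : n < n') (hs : 1 ≤ s) :
    chooseLE n s < chooseLE n' s := by
  obtain ⟨s, rfl⟩ := Nat.exists_eq_add_of_le' hs
  have h₁ : chooseLE (n + 1) (s + 1) ≤ chooseLE n' (s + 1) := chooseLE_mono_left (s + 1) h
  have := chooseLE_pos n s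
  rw [chooseLE_succ_succ] at h₁
  omega

theorem chooseLE_succ_le_choose (k p : ℕ) :
    chooseLE k (p + 1) ≤ (p + k).choose (p + 1) + 1 := by
  induction k generalizing p with
  | zero => simp [chooseLE_zero_left]
  | succ k ih =>
    cases p with
    | zero => simp [chooseLE_succ_right, chooseLE_zero_right]; omega
    | succ p =>
      have h₁ := ih (p + 1)
      have h₂ := ih p
      have h₃ : 0 < (p + k).choose p := Nat.choose_pos (by omega)
      have h₄ : (p + 1 + (k + 1)).choose (p + 1 + 1) =
          (p + k + 1).choose (p + 1) + (p + k + 1).choose (p + 2) := by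
        rw [show p + 1 + (k + 1) = p + k + 1 + 1 by omega, Nat.choose_succ_succ']
      have h₅ := Nat.choose_succ_succ' (p + k) p
      rw [show p + 1 + k = p + k + 1 by omega] at h₁
      rw [chooseLE_succ_succ, h₄]
      rw [show p + 1 + 1 = p + 2 from rfl] at *
      omega

theorem chooseLE_add_chooseLE_sub_le {m p s : ℕ} (hps : p < s) (hpm : p ≤ m) :
    chooseLE m p + chooseLE (m - p) s ≤ chooseLE m s + 1 := by
  obtain ⟨k, rfl⟩ := Nat.exists_eq_add_of_le hpm
  rw [Nat.add_sub_cancel_left]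
  induction s, hps using Nat.le_induction with
  | base =>
    have := chooseLE_succ_le_choose k p
    rw [Nat.succ_eq_add_one, chooseLE_succ_right (p + k)]
    omega
  | succ s hs ih =>
    have : k.choose (s + 1) ≤ (p + k).choose (s + 1) := Nat.choose_le_choose _ (by omega)
    rw [chooseLE_succ_right, chooseLE_succ_right]
    omega

theorem chooseLE_add_chooseLE_sub_succ_le {m p s : ℕ} (hps : p < s) (hpm : p < m) :
    chooseLE m p + chooseLE (m - (p + 1)) s ≤ chooseLE m s := by
  have h₁ := chooseLE_add_chooseLE_sub_le hps hpm.le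
  have h₂ : chooseLE (m - (p + 1)) s < chooseLE (m - p) s :=
    chooseLE_lt_of_lt (by omega) (by omega)
  omega

section Families

variable {α : Type*}

/-- The family of subsets of `G` of size at most `r`. -/
def subsetsLE (G : Finset α) (r : ℕ) : Finset (Finset α) := {A ∈ G.powerset | #A ≤ r}

theorem mem_subsetsLE {G A : Finset α} {r : ℕ} : A ∈ subsetsLE G r ↔ A ⊆ G ∧ #A ≤ r := by
  simp [subsetsLE]

theorem card_subsetsLE (G : Finset α) (r : ℕ) : #(subsetsLE G r) = chooseLE #G r := by
  classical
  rw [card_eq_sum_card_fiberwise (f := card) (t := range (r + 1))]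
  · refine sum_congr rfl fun i hi => ?_
    rw [← card_powersetCard]
    congr 1
    ext A
    have := mem_range.1 hi
    simp only [mem_filter, mem_subsetsLE, mem_powersetCard]
    constructor
    · exact fun h => ⟨h.1.1, h.2⟩
    · exact fun h => ⟨⟨h.1, by omega⟩, h.2⟩
  · intro A hA
    have := (mem_subsetsLE.1 hA).2
    simpa using Nat.lt_succ_of_le this

theorem card_le_chooseLE {G : Finset α} {r : ℕ} {𝒜 : Finset (Finset α)}
    (h : 𝒜 ⊆ subsetsLE G r) : #𝒜 ≤ chooseLE #G r :=
  card_subsetsLE G r ▸ card_le_card h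

variable [DecidableEq α]

/-- Every member of `𝒜` meets every member of `ℬ`. -/
def CrossIntersecting (𝒜 ℬ : Finset (Finset α)) : Prop :=
  ∀ A ∈ 𝒜, ∀ B ∈ ℬ, (A ∩ B).Nonempty

theorem CrossIntersecting.symm {𝒜 ℬ : Finset (Finset α)} (h : CrossIntersecting 𝒜 ℬ) :
    CrossIntersecting ℬ 𝒜 := fun B hB A hA => inter_comm A B ▸ h A hA B hB

theorem CrossIntersecting.mono {𝒜 ℬ 𝒜' ℬ' : Finset (Finset α)} (h : CrossIntersecting 𝒜 ℬ)
    (hA : 𝒜' ⊆ 𝒜) (hB : ℬ' ⊆ ℬ) : CrossIntersecting 𝒜' ℬ' :=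
  fun A h₁ B h₂ => h A (hA h₁) B (hB h₂)

theorem card_subsetsLE_inter_nonempty (G S : Finset α) (s : ℕ) (hS : S ⊆ G) :
    #{B ∈ subsetsLE G s | (S ∩ B).Nonempty} + chooseLE (#G - #S) s = chooseLE #G s := by
  rw [← card_subsetsLE G s, ← card_sdiff_of_subset hS, ← card_subsetsLE,
    ← card_filter_add_card_filter_not (s := subsetsLE G s) (fun B => (S ∩ B).Nonempty)]
  congr 2
  ext B
  simp only [mem_subsetsLE, mem_filter, not_nonempty_iff_eq_empty, ← disjoint_iff_inter_eq_empty,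
    subset_sdiff]
  rw [disjoint_comm]
  tauto

theorem card_add_chooseLE_le_of_inter_nonempty {G S : Finset α} {r s : ℕ}
    {ℬ : Finset (Finset α)} (hS : S ∈ subsetsLE G r) (hB : ℬ ⊆ subsetsLE G s)
    (h : ∀ B ∈ ℬ, (S ∩ B).Nonempty) :
    #ℬ + chooseLE (#G - r) s ≤ chooseLE #G s := by
  obtain ⟨hSG, hSr⟩ := mem_subsetsLE.1 hS
  rw [← card_subsetsLE_inter_nonempty G S s hSG]
  have h₁ : #ℬ ≤ #{B ∈ subsetsLE G s | (S ∩ B).Nonempty} :=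
    card_le_card fun B hBm => mem_filter.2 ⟨hB hBm, h B hBm⟩
  have h₂ : chooseLE (#G - r) s ≤ chooseLE (#G - #S) s :=
    chooseLE_mono_left s (Nat.sub_le_sub_left hSr _)
  omega

theorem CrossIntersecting.card_add_card_le_of_sdiff_mem {G : Finset α}
    {𝒜 ℬ 𝒟 : Finset (Finset α)} (h : CrossIntersecting 𝒜 ℬ) (hA : 𝒜 ⊆ 𝒟)
    (hBG : ∀ B ∈ ℬ, B ⊆ G) (hB : ∀ B ∈ ℬ, G \ B ∈ 𝒟) : #𝒜 + #ℬ ≤ #𝒟 := by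
  have hinj : Set.InjOn (fun B => G \ B) (ℬ : Set (Finset α)) := by
    intro B hB B' hB' hEq
    have := congrArg (fun X => G \ X) hEq
    simpa [inter_eq_right.2 (hBG B hB), inter_eq_right.2 (hBG B' hB')] using this
  rw [← card_image_of_injOn hinj, ← card_union_of_disjoint]
  · refine card_le_card (union_subset hA fun X hX => ?_)
    obtain ⟨B, hBm, rfl⟩ := mem_image.1 hX
    exact hB B hBm
  · rw [disjoint_left]
    intro X hX hX'
    obtain ⟨B, hBm, rfl⟩ := mem_image.1 hX'
    have := h _ hX B hBm
    simp at this

/-- Non-empty cross-intersecting families of subsets of `G` of sizes at most `r` and `s` have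
total size at most `1` plus the number of sets of size at most `s` that meet a fixed `r`-set. -/
def CrossSumBound (G : Finset α) (r s : ℕ) : Prop :=
  ∀ 𝒜 ℬ : Finset (Finset α), 𝒜 ⊆ subsetsLE G r → ℬ ⊆ subsetsLE G s → 𝒜.Nonempty → ℬ.Nonempty →
    CrossIntersecting 𝒜 ℬ → #𝒜 + #ℬ + chooseLE (#G - r) s ≤ chooseLE #G s + 1

theorem crossSumBound_zero (G : Finset α) (s : ℕ) : CrossSumBound G 0 s := by
  rintro 𝒜 ℬ hA - ⟨A, hAm⟩ ⟨B, hBm⟩ h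
  have h₁ := (mem_subsetsLE.1 (hA hAm)).2
  have h₂ := h A hAm B hBm
  rw [card_eq_zero.1 (Nat.le_zero.1 h₁)] at h₂
  simp at h₂

theorem crossSumBound_of_card_le {G : Finset α} {r s : ℕ} (hr : #G ≤ r) (hrs : r ≤ s) :
    CrossSumBound G r s := by
  intro 𝒜 ℬ hA hB _ _ h
  have hmem : ∀ A ⊆ G, A ∈ subsetsLE G s := fun A hAG =>
    mem_subsetsLE.2 ⟨hAG, (card_le_card hAG).trans (hr.trans hrs)⟩
  have := h.card_add_card_le_of_sdiff_mem (G := G) (𝒟 := subsetsLE G s)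
    (fun A hAm => hmem A (mem_subsetsLE.1 (hA hAm)).1) (fun B hBm => (mem_subsetsLE.1 (hB hBm)).1)
    (fun B _ => hmem _ sdiff_subset)
  rw [card_subsetsLE] at this
  rw [Nat.sub_eq_zero_of_le hr, chooseLE_zero_left]
  omega

section Split

variable {a : α} {G : Finset α} {r : ℕ} {𝒜 ℬ : Finset (Finset α)}

theorem memberSubfamily_subset_subsetsLE (h : 𝒜 ⊆ subsetsLE (insert a G) (r + 1)) :
    𝒜.memberSubfamily a ⊆ subsetsLE G r := by
  intro A hA
  obtain ⟨hA, ha⟩ := mem_memberSubfamily.1 hA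
  obtain ⟨h₁, h₂⟩ := mem_subsetsLE.1 (h hA)
  rw [card_insert_of_notMem ha] at h₂
  exact mem_subsetsLE.2 ⟨(insert_subset_insert_iff ha).1 h₁, by omega⟩

theorem nonMemberSubfamily_subset_subsetsLE (h : 𝒜 ⊆ subsetsLE (insert a G) r) :
    𝒜.nonMemberSubfamily a ⊆ subsetsLE G r := by
  intro A hA
  obtain ⟨hA, ha⟩ := mem_nonMemberSubfamily.1 hA
  obtain ⟨h₁, h₂⟩ := mem_subsetsLE.1 (h hA)
  exact mem_subsetsLE.2 ⟨(subset_insert_iff_of_notMem ha).1 h₁, h₂⟩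

theorem nonMemberSubfamily_subset_self : 𝒜.nonMemberSubfamily a ⊆ 𝒜 :=
  fun _ h => (mem_nonMemberSubfamily.1 h).1

theorem CrossIntersecting.memberSubfamily_nonMemberSubfamily (h : CrossIntersecting 𝒜 ℬ) :
    CrossIntersecting (𝒜.memberSubfamily a) (ℬ.nonMemberSubfamily a) := by
  intro A hA B hB
  obtain ⟨hB, ha⟩ := mem_nonMemberSubfamily.1 hB
  simpa [insert_inter_of_notMem ha] using h _ (mem_memberSubfamily.1 hA).1 B hB

theorem nonempty_subfamily_of_nonempty (h : 𝒜.Nonempty) :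
    (𝒜.memberSubfamily a).Nonempty ∨ (𝒜.nonMemberSubfamily a).Nonempty := by
  have := card_memberSubfamily_add_card_nonMemberSubfamily a 𝒜
  have := h.card_pos
  rw [← card_pos, ← card_pos]
  omega

end Split

theorem CrossSumBound.insert_of_lt {G : Finset α} {a : α} (ha : a ∉ G)
    (ih : ∀ r s, r ≤ s → CrossSumBound G r s) {r s : ℕ} (hrs : r < s) (hr : r ≤ #G) :
    CrossSumBound (insert a G) r s := by
  cases r with
  | zero => exact crossSumBound_zero _ _
  | succ r =>
  obtain ⟨s, rfl⟩ : ∃ t, s = t + 1 := ⟨s - 1, by omega⟩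
  intro 𝒜 ℬ hA hB hA' hB' h
  have cA := card_memberSubfamily_add_card_nonMemberSubfamily a 𝒜
  have cB := card_memberSubfamily_add_card_nonMemberSubfamily a ℬ
  have sA₁ := memberSubfamily_subset_subsetsLE hA
  have sA₀ := nonMemberSubfamily_subset_subsetsLE hA
  have sB₁ := memberSubfamily_subset_subsetsLE hB
  have sB₀ := nonMemberSubfamily_subset_subsetsLE hB
  have h₁₀ := h.memberSubfamily_nonMemberSubfamily (a := a)
  have h₀₁ := (h.symm.memberSubfamily_nonMemberSubfamily (a := a)).symm
  have h₀₀ := h.mono (nonMemberSubfamily_subset_self (a := a))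
    (nonMemberSubfamily_subset_self (a := a))
  have neA := nonempty_subfamily_of_nonempty (a := a) hA'
  have neB := nonempty_subfamily_of_nonempty (a := a) hB'
  generalize 𝒜.memberSubfamily a = 𝒜₁ at *
  generalize 𝒜.nonMemberSubfamily a = 𝒜₀ at *
  generalize ℬ.memberSubfamily a = ℬ₁ at *
  generalize ℬ.nonMemberSubfamily a = ℬ₀ at *
  have eG := chooseLE_succ_succ #G s
  have eR := chooseLE_succ_succ (#G - (r + 1)) s
  rw [card_insert_of_notMem ha]
  rw [show #G + 1 - (r + 1) = #G - (r + 1) + 1 by omega]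
  have cA₁ := card_le_chooseLE sA₁
  have cB₁ := card_le_chooseLE sB₁
  have eR' : #G - (r + 1) + 1 = #G - r := by omega
  rcases 𝒜₀.eq_empty_or_nonempty with rfl | neA₀
  · rw [card_empty] at cA
    rw [eR']
    rcases ℬ₀.eq_empty_or_nonempty with rfl | neB₀
    · rw [card_empty] at cB
      have := chooseLE_add_chooseLE_sub_le (m := #G) (p := r) (s := s + 1) (by omega) (by omega)
      omega
    · have := ih r (s + 1) (by omega) _ _ sA₁ sB₀ (by simpa using neA) neB₀ h₁₀
      omega
  rcases ℬ₁.eq_empty_or_nonempty with rfl | neB₁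
  · have h₁ := ih (r + 1) (s + 1) (by omega) _ _ sA₀ sB₀ neA₀ (by simpa using neB) h₀₀
    have h₂ := chooseLE_add_chooseLE_sub_succ_le (m := #G) (p := r) (s := s) (by omega) (by omega)
    rw [card_empty] at cB
    omega
  have h₂ := ih (r + 1) s (by omega) _ _ sA₀ sB₁ neA₀ neB₁ h₀₁
  suffices #𝒜₁ + #ℬ₀ + chooseLE (#G - (r + 1)) (s + 1) ≤ chooseLE #G (s + 1) by omega
  rcases 𝒜₁.eq_empty_or_nonempty with rfl | neA₁
  · obtain ⟨S, hS⟩ := neA₀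
    simpa using card_add_chooseLE_le_of_inter_nonempty (sA₀ hS) sB₀ (h₀₀ S hS)
  rcases ℬ₀.eq_empty_or_nonempty with rfl | neB₀
  · have := chooseLE_add_chooseLE_sub_succ_le (m := #G) (p := r) (s := s + 1) (by omega) (by omega)
    rw [card_empty]
    omega
  have h₃ := ih r (s + 1) (by omega) _ _ sA₁ sB₀ neA₁ neB₀ h₁₀
  have h₄ : chooseLE (#G - (r + 1)) (s + 1) < chooseLE (#G - r) (s + 1) :=
    chooseLE_lt_of_lt (by omega) (by omega)
  omega

section Shift

open UV

theorem compress_singleton (i a : α) (A : Finset α) :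
    compress {i} {a} A = if i ∉ A ∧ a ∈ A then (insert i A) \ {a} else A := by
  simp only [compress, disjoint_singleton_left, singleton_subset_iff, sup_eq_union]
  congr 1
  rw [union_comm, ← insert_eq]

theorem card_compress_singleton (i a : α) (A : Finset α) : #(compress {i} {a} A) = #A :=
  card_compress (by simp) A

theorem mem_of_mem_compression_of_mem {i a : α} {𝒜 : Finset (Finset α)}
    {A : Finset α} (hA : A ∈ compression {i} {a} 𝒜) (ha : a ∈ A) : A ∈ 𝒜 := by
  rcases mem_compression.1 hA with h | ⟨-, B, hB, rfl⟩
  · exact h.1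
  · rw [compress_singleton] at ha ⊢
    by_cases hc : i ∉ B ∧ a ∈ B
    · simp [hc] at ha
    · rwa [if_neg hc]

theorem compression_subset_subsetsLE {i a : α} {G : Finset α} {r : ℕ} {𝒜 : Finset (Finset α)}
    (hi : i ∈ G) (h : 𝒜 ⊆ subsetsLE G r) : compression {i} {a} 𝒜 ⊆ subsetsLE G r := by
  intro A hA
  rcases mem_compression.1 hA with hA | ⟨-, B, hB, rfl⟩
  · exact h hA.1
  · obtain ⟨h₁, h₂⟩ := mem_subsetsLE.1 (h hB)
    refine mem_subsetsLE.2 ⟨?_, by rwa [card_compress_singleton]⟩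
    rw [compress_singleton]
    split_ifs
    · exact sdiff_subset.trans (insert_subset hi h₁)
    · exact h₁

theorem inter_nonempty_of_compress_mem {i a : α} (hia : i ≠ a) {𝒜 ℬ : Finset (Finset α)}
    (h : CrossIntersecting 𝒜 ℬ) {A B : Finset α} (hA : A ∈ 𝒜)
    (hA' : compress {i} {a} A ∈ 𝒜) (hB : B ∈ ℬ) : (A ∩ compress {i} {a} B).Nonempty := by
  have h₁ := h _ hA _ hB
  have h₂ := h _ hA' _ hB
  rw [compress_singleton] at h₂ ⊢
  obtain ⟨x, hx⟩ := h₁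
  obtain ⟨y, hy⟩ := h₂
  by_cases hiA : i ∈ A
  · by_cases hc : i ∉ B ∧ a ∈ B
    · exact ⟨i, by simp [hc, hiA, hia]⟩
    · exact ⟨x, by simpa [hc] using hx⟩
  · by_cases hc : i ∉ B ∧ a ∈ B
    · by_cases haA : a ∈ A
      · refine ⟨y, ?_⟩
        simp only [hiA, haA, not_false_eq_true, and_self, if_true, mem_inter, mem_sdiff, mem_insert,
          mem_singleton] at hy
        grind
      · refine ⟨x, ?_⟩
        grind
    · exact ⟨x, by simpa [hc] using hx⟩

theorem CrossIntersecting.compression {i a : α} (hia : i ≠ a) {𝒜 ℬ : Finset (Finset α)}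
    (h : CrossIntersecting 𝒜 ℬ) :
    CrossIntersecting (compression {i} {a} 𝒜) (compression {i} {a} ℬ) := by
  intro A hA B hB
  rcases mem_compression.1 hA with ⟨hA₁, hA₂⟩ | ⟨hA₁, A', hA', rfl⟩ <;>
  rcases mem_compression.1 hB with ⟨hB₁, hB₂⟩ | ⟨hB₁, B', hB', rfl⟩
  · exact h A hA₁ B hB₁
  · exact inter_nonempty_of_compress_mem hia h hA₁ hA₂ hB'
  · rw [inter_comm]
    exact inter_nonempty_of_compress_mem hia h.symm hB₁ hB₂ hA'
  · refine ⟨i, ?_⟩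
    rw [compress_singleton] at *
    rw [compress_singleton] at *
    grind

theorem filter_mem_compression_subset (i a : α) (𝒜 : Finset (Finset α)) :
    {A ∈ compression {i} {a} 𝒜 | a ∈ A} ⊆ {A ∈ 𝒜 | a ∈ A} := by
  intro A hA
  obtain ⟨hA, ha⟩ := mem_filter.1 hA
  exact mem_filter.2 ⟨mem_of_mem_compression_of_mem hA ha, ha⟩

theorem card_filter_mem_compression_lt {i a : α} {𝒜 : Finset (Finset α)}
    {A : Finset α} (hA : A ∈ 𝒜) (haA : a ∈ A) (hA' : compress {i} {a} A ∉ 𝒜) :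
    #{A ∈ compression {i} {a} 𝒜 | a ∈ A} < #{A ∈ 𝒜 | a ∈ A} := by
  refine card_lt_card ⟨filter_mem_compression_subset i a 𝒜, fun hsub => ?_⟩
  have h₁ := (mem_filter.1 (hsub (mem_filter.2 ⟨hA, haA⟩))).1
  rcases mem_compression.1 h₁ with h | h
  · exact hA' h.2
  · exact h.1 hA

/-- Repeatedly replacing `a` by other elements makes a pair of cross-intersecting families
stable under all such replacements. -/
theorem CrossIntersecting.exists_stable {G : Finset α} (a : α) {r s : ℕ}
    {𝒜 ℬ : Finset (Finset α)} (hA : 𝒜 ⊆ subsetsLE G r) (hB : ℬ ⊆ subsetsLE G s)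
    (h : CrossIntersecting 𝒜 ℬ) :
    ∃ 𝒜' ℬ' : Finset (Finset α), #𝒜' = #𝒜 ∧ #ℬ' = #ℬ ∧ 𝒜' ⊆ subsetsLE G r ∧
      ℬ' ⊆ subsetsLE G s ∧ CrossIntersecting 𝒜' ℬ' ∧
      (∀ i ∈ G, i ≠ a → ∀ A ∈ 𝒜', a ∈ A → compress {i} {a} A ∈ 𝒜') ∧
      (∀ i ∈ G, i ≠ a → ∀ B ∈ ℬ', a ∈ B → compress {i} {a} B ∈ ℬ') := by
  induction hN : #{A ∈ 𝒜 | a ∈ A} + #{B ∈ ℬ | a ∈ B} using Nat.strong_induction_on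
    generalizing 𝒜 ℬ with
  | _ N ih =>
  by_cases hst : (∀ i ∈ G, i ≠ a → ∀ A ∈ 𝒜, a ∈ A → compress {i} {a} A ∈ 𝒜) ∧
      (∀ i ∈ G, i ≠ a → ∀ B ∈ ℬ, a ∈ B → compress {i} {a} B ∈ ℬ)
  · exact ⟨𝒜, ℬ, rfl, rfl, hA, hB, h, hst⟩
  obtain ⟨i, hi, hia, hlt⟩ : ∃ i ∈ G, i ≠ a ∧
      #{A ∈ UV.compression {i} {a} 𝒜 | a ∈ A} + #{B ∈ UV.compression {i} {a} ℬ | a ∈ B} <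
        #{A ∈ 𝒜 | a ∈ A} + #{B ∈ ℬ | a ∈ B} := by
    rw [not_and_or] at hst
    push Not at hst
    rcases hst with ⟨i, hi, hia, A, hAm, haA, hA'⟩ | ⟨i, hi, hia, A, hAm, haA, hA'⟩
    · exact ⟨i, hi, hia, add_lt_add_of_lt_of_le (card_filter_mem_compression_lt hAm haA hA')
        (card_le_card (filter_mem_compression_subset i a _))⟩
    · exact ⟨i, hi, hia, add_lt_add_of_le_of_lt
        (card_le_card (filter_mem_compression_subset i a _))
        (card_filter_mem_compression_lt hAm haA hA')⟩
  obtain ⟨𝒜', ℬ', h₁, h₂, h₃⟩ := ih _ (hN ▸ hlt) (compression_subset_subsetsLE hi hA)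
    (compression_subset_subsetsLE hi hB) (h.compression hia) rfl
  rw [card_compression] at h₁ h₂
  exact ⟨𝒜', ℬ', h₁, h₂, h₃⟩

theorem nonMemberSubfamily_nonempty_of_stable {G : Finset α} {a : α} {r : ℕ}
    {𝒜 : Finset (Finset α)} (ha : a ∉ G) (hr : r ≤ #G) (hA : 𝒜 ⊆ subsetsLE (insert a G) r)
    (hne : 𝒜.Nonempty)
    (h : ∀ i ∈ insert a G, i ≠ a → ∀ A ∈ 𝒜, a ∈ A → compress {i} {a} A ∈ 𝒜) :
    (𝒜.nonMemberSubfamily a).Nonempty := by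
  obtain ⟨A, hAm⟩ := hne
  by_cases haA : a ∈ A
  · have hcard : #A < #(insert a G) := by
      have := (mem_subsetsLE.1 (hA hAm)).2
      rw [card_insert_of_notMem ha]
      omega
    obtain ⟨i, hi, hiA⟩ := exists_mem_notMem_of_card_lt_card hcard
    have hia : i ≠ a := by rintro rfl; exact hiA haA
    refine ⟨_, mem_nonMemberSubfamily.2 ⟨h i hi hia A hAm haA, ?_⟩⟩
    simp [compress_singleton, hiA, haA]
  · exact ⟨A, mem_nonMemberSubfamily.2 ⟨hAm, haA⟩⟩

theorem CrossIntersecting.memberSubfamily_memberSubfamily_of_stable {G : Finset α} {a : α}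
    {r s : ℕ} {𝒜 ℬ : Finset (Finset α)} (ha : a ∉ G) (hrs : r + s ≤ #G + 1)
    (hA : 𝒜 ⊆ subsetsLE (insert a G) r) (hB : ℬ ⊆ subsetsLE (insert a G) s)
    (hcross : CrossIntersecting 𝒜 ℬ)
    (h : ∀ i ∈ insert a G, i ≠ a → ∀ A ∈ 𝒜, a ∈ A → compress {i} {a} A ∈ 𝒜) :
    CrossIntersecting (𝒜.memberSubfamily a) (ℬ.memberSubfamily a) := by
  intro A hAm B hBm
  obtain ⟨hAm, haA⟩ := mem_memberSubfamily.1 hAm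
  obtain ⟨hBm, haB⟩ := mem_memberSubfamily.1 hBm
  have h₁ := (mem_subsetsLE.1 (hA hAm)).2
  have h₂ := (mem_subsetsLE.1 (hB hBm)).2
  rw [card_insert_of_notMem haA] at h₁
  rw [card_insert_of_notMem haB] at h₂
  obtain ⟨i, hi, hiAB⟩ : ∃ i ∈ G, i ∉ A ∪ B :=
    exists_mem_notMem_of_card_lt_card ((card_union_le A B).trans_lt (by omega))
  have hia : i ≠ a := by rintro rfl; exact ha hi
  rw [mem_union, not_or] at hiAB
  have h₃ := h i (mem_insert_of_mem hi) hia _ hAm (mem_insert_self a A)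
  obtain ⟨x, hx⟩ := hcross _ h₃ _ hBm
  rw [compress_singleton] at hx
  refine ⟨x, ?_⟩
  grind

end Shift

theorem CrossSumBound.insert_self_of_two_mul_le {G : Finset α} {a : α} (ha : a ∉ G)
    (ih : ∀ r, CrossSumBound G r r) {r : ℕ} (hr : 2 * r ≤ #G + 1) (hrG : r ≤ #G) :
    CrossSumBound (insert a G) r r := by
  cases r with
  | zero => exact crossSumBound_zero _ _
  | succ r =>
  intro 𝒜' ℬ' hA' hB' neA' neB' h'
  obtain ⟨𝒜, ℬ, eA, eB, hA, hB, h, stA, stB⟩ := h'.exists_stable a hA' hB'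
  rw [← eA, ← eB]
  rw [← card_pos, ← eA, card_pos] at neA'
  rw [← card_pos, ← eB, card_pos] at neB'
  have neA₀ := nonMemberSubfamily_nonempty_of_stable ha hrG hA neA' stA
  have neB₀ := nonMemberSubfamily_nonempty_of_stable ha hrG hB neB' stB
  have h₁₁ := h.memberSubfamily_memberSubfamily_of_stable ha (by omega) hA hB stA
  have cA := card_memberSubfamily_add_card_nonMemberSubfamily a 𝒜
  have cB := card_memberSubfamily_add_card_nonMemberSubfamily a ℬ
  have sA₁ := memberSubfamily_subset_subsetsLE hA
  have sA₀ := nonMemberSubfamily_subset_subsetsLE hA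
  have sB₁ := memberSubfamily_subset_subsetsLE hB
  have sB₀ := nonMemberSubfamily_subset_subsetsLE hB
  have h₁₀ := h.memberSubfamily_nonMemberSubfamily (a := a)
  have h₀₁ := (h.symm.memberSubfamily_nonMemberSubfamily (a := a)).symm
  have h₀₀ := h.mono (nonMemberSubfamily_subset_self (a := a))
    (nonMemberSubfamily_subset_self (a := a))
  generalize 𝒜.memberSubfamily a = 𝒜₁ at *
  generalize 𝒜.nonMemberSubfamily a = 𝒜₀ at *
  generalize ℬ.memberSubfamily a = ℬ₁ at *
  generalize ℬ.nonMemberSubfamily a = ℬ₀ at *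
  have eG := chooseLE_succ_succ #G r
  have eR := chooseLE_succ_succ (#G - (r + 1)) r
  rw [card_insert_of_notMem ha, show #G + 1 - (r + 1) = #G - (r + 1) + 1 by omega]
  have h₁ := ih (r + 1) _ _ sA₀ sB₀ neA₀ neB₀ h₀₀
  suffices #𝒜₁ + #ℬ₁ + chooseLE (#G - (r + 1)) r ≤ chooseLE #G r by omega
  rcases 𝒜₁.eq_empty_or_nonempty with rfl | neA₁
  · obtain ⟨S, hS⟩ := neA₀
    simpa using card_add_chooseLE_le_of_inter_nonempty (sA₀ hS) sB₁ (h₀₁ S hS)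
  rcases ℬ₁.eq_empty_or_nonempty with rfl | neB₁
  · obtain ⟨S, hS⟩ := neB₀
    simpa using card_add_chooseLE_le_of_inter_nonempty (sB₀ hS) sA₁ (h₁₀.symm S hS)
  have h₂ := ih r _ _ sA₁ sB₁ neA₁ neB₁ h₁₁
  rcases Nat.eq_zero_or_pos r with rfl | hr0
  · have := neA₁.card_pos
    have := neB₁.card_pos
    simp only [chooseLE_zero_right] at *
    omega
  have h₃ : chooseLE (#G - (r + 1)) r < chooseLE (#G - r) r := chooseLE_lt_of_lt (by omega) hr0
  omega

theorem CrossSumBound.self_of_card_le_two_mul {G : Finset α} {r : ℕ} (hrG : r < #G)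
    (hr : #G ≤ 2 * r) (ih : CrossSumBound G (#G - r - 1) (#G - r - 1)) : CrossSumBound G r r := by
  intro 𝒜 ℬ hA hB neA neB h
  obtain ⟨t, ht⟩ : ∃ t, #G - r = t + 1 := ⟨#G - r - 1, by omega⟩
  rw [ht, Nat.add_sub_cancel] at ih
  have hsmall (𝒞 : Finset (Finset α)) (hC : 𝒞 ⊆ subsetsLE G r) :
      {C ∈ 𝒞 | #C ≤ t} ⊆ subsetsLE G t := fun C hCm => by
    obtain ⟨h₁, h₂⟩ := mem_filter.1 hCm
    exact mem_subsetsLE.2 ⟨(mem_subsetsLE.1 (hC h₁)).1, h₂⟩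
  have hlarge : #{A ∈ 𝒜 | ¬ #A ≤ t} + #{B ∈ ℬ | ¬ #B ≤ t} ≤ #(subsetsLE G r \ subsetsLE G t) := by
    refine (h.mono (filter_subset _ _) (filter_subset _ _)).card_add_card_le_of_sdiff_mem (G := G)
      (fun A hAm => ?_) (fun B hBm => (mem_subsetsLE.1 (hB (mem_filter.1 hBm).1)).1)
      (fun B hBm => ?_)
    · obtain ⟨h₁, h₂⟩ := mem_filter.1 hAm
      exact mem_sdiff.2 ⟨hA h₁, fun h₃ => h₂ (mem_subsetsLE.1 h₃).2⟩
    · obtain ⟨h₁, h₂⟩ := mem_filter.1 hBm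
      obtain ⟨h₃, h₄⟩ := mem_subsetsLE.1 (hB h₁)
      simp only [mem_sdiff, mem_subsetsLE, card_sdiff_of_subset h₃, sdiff_subset, true_and]
      omega
  have hsub : subsetsLE G t ⊆ subsetsLE G r := fun C hC =>
    mem_subsetsLE.2 ⟨(mem_subsetsLE.1 hC).1, (mem_subsetsLE.1 hC).2.trans (by omega)⟩
  rw [card_sdiff_of_subset hsub] at hlarge
  have hle := card_le_card hsub
  rw [card_subsetsLE, card_subsetsLE] at hlarge hle
  have cA := card_filter_add_card_filter_not (s := 𝒜) (fun A => #A ≤ t)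
  have cB := card_filter_add_card_filter_not (s := ℬ) (fun B => #B ≤ t)
  have htop : chooseLE (t + 1) r = chooseLE (t + 1) t + 1 := by
    have h₁ : t + 1 ≤ r := by omega
    clear * - h₁
    induction r, h₁ using Nat.le_induction with
    | base => simp [chooseLE_succ_right]
    | succ r hr ih => rw [chooseLE_succ_right, ih, Nat.choose_eq_zero_of_lt (by omega)]
  rw [ht, htop]
  suffices #{A ∈ 𝒜 | #A ≤ t} + #{B ∈ ℬ | #B ≤ t} + chooseLE (t + 1) t ≤ chooseLE #G t by omega
  have sA := hsmall 𝒜 hA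
  have sB := hsmall ℬ hB
  rcases ({A ∈ 𝒜 | #A ≤ t} : Finset _).eq_empty_or_nonempty with hA₀ | neA₀
  · obtain ⟨S, hS⟩ := neA
    have := card_add_chooseLE_le_of_inter_nonempty (hA hS) sB
      fun B hBm => h S hS B (mem_filter.1 hBm).1
    rw [ht] at this
    simpa [hA₀] using this
  rcases ({B ∈ ℬ | #B ≤ t} : Finset _).eq_empty_or_nonempty with hB₀ | neB₀
  · obtain ⟨S, hS⟩ := neB
    have := card_add_chooseLE_le_of_inter_nonempty (hB hS) sA
      fun A hAm => h.symm S hS A (mem_filter.1 hAm).1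
    rw [ht] at this
    simpa [hB₀] using this
  have h₁ := ih _ _ sA sB neA₀ neB₀ (h.mono (filter_subset _ _) (filter_subset _ _))
  rcases Nat.eq_zero_or_pos t with rfl | ht0
  · have := neA₀.card_pos
    have := neB₀.card_pos
    simp only [chooseLE_zero_right] at *
    omega
  have h₂ : chooseLE (t + 1) t < chooseLE (#G - t) t := chooseLE_lt_of_lt (by omega) ht0
  omega

theorem crossSumBound (G : Finset α) {r s : ℕ} (hrs : r ≤ s) : CrossSumBound G r s := by
  induction G using Finset.induction_on generalizing r s with
  | empty => exact crossSumBound_of_card_le (by simp) hrs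
  | insert a G ha ih =>
    have hcard := card_insert_of_notMem ha
    rcases le_or_gt #(insert a G) r with hr | hr
    · exact crossSumBound_of_card_le hr hrs
    rcases hrs.lt_or_eq with hlt | rfl
    · exact CrossSumBound.insert_of_lt ha (fun _ _ => ih) hlt (by omega)
    have key {t : ℕ} (ht : 2 * t ≤ #G + 1) (htG : t ≤ #G) : CrossSumBound (insert a G) t t :=
      CrossSumBound.insert_self_of_two_mul_le ha (fun _ => ih le_rfl) ht htG
    rcases le_or_gt #(insert a G) (2 * r) with h2 | h2
    · exact CrossSumBound.self_of_card_le_two_mul hr h2 (key (by omega) (by omega))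
    · exact key (by omega) (by omega)

end Families

theorem sum_choose_sub_choose_add_chooseLE {n k : ℕ} (h : k ≤ n) (s : ℕ) :
    ∑ i ∈ Finset.Icc 1 s, (n.choose i - k.choose i) + chooseLE k s = chooseLE n s := by
  induction s with
  | zero => simp [chooseLE_zero_right]
  | succ s ih =>
    have := Nat.choose_le_choose (s + 1) h
    rw [sum_Icc_succ_top (by omega), chooseLE_succ_right, chooseLE_succ_right]
    omega

theorem borg_feghali_is_greatest (n r s : ℕ) (hn : 1 ≤ n) (hr : 1 ≤ r) (hrs : r ≤ s) :
    IsGreatest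
      {m : ℕ | ∃ 𝒜 ℬ : Finset (Finset ℕ),
        (∀ A ∈ 𝒜, A ⊆ Finset.Icc 1 n ∧ A.card ≤ r) ∧
        (∀ B ∈ ℬ, B ⊆ Finset.Icc 1 n ∧ B.card ≤ s) ∧
        𝒜.Nonempty ∧ ℬ.Nonempty ∧
        (∀ A ∈ 𝒜, ∀ B ∈ ℬ, (A ∩ B).Nonempty) ∧
        m = 𝒜.card + ℬ.card}
      (1 + ∑ i ∈ Finset.Icc 1 s, (n.choose i - (n - r).choose i)) := by
  have hsum := sum_choose_sub_choose_add_chooseLE (Nat.sub_le n r) s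
  constructor
  · have hS : Finset.Icc 1 (min r n) ⊆ Finset.Icc 1 n :=
      Finset.Icc_subset_Icc_right (min_le_right r n)
    have hcard := card_subsetsLE_inter_nonempty _ _ s hS
    simp only [Nat.card_Icc, Nat.add_sub_cancel] at hcard
    rw [show n - min r n = n - r by omega] at hcard
    refine ⟨{Finset.Icc 1 (min r n)},
      {B ∈ subsetsLE (Finset.Icc 1 n) s | (Finset.Icc 1 (min r n) ∩ B).Nonempty},
      ?_, ?_, singleton_nonempty _, ⟨{1}, ?_⟩, ?_, ?_⟩
    · simp only [mem_singleton, forall_eq]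
      exact ⟨hS, by simp⟩
    · exact fun B hB => mem_subsetsLE.1 (mem_filter.1 hB).1
    · refine mem_filter.2 ⟨mem_subsetsLE.2 ⟨by simpa using hn, by simp; omega⟩, 1, ?_⟩
      simp
      omega
    · simp only [mem_singleton, forall_eq]
      exact fun B hB => (mem_filter.1 hB).2
    · rw [card_singleton]
      omega
  · rintro m ⟨𝒜, ℬ, hA, hB, neA, neB, h, rfl⟩
    have := crossSumBound (Finset.Icc 1 n) hrs 𝒜 ℬ (fun A hAm => mem_subsetsLE.2 (hA A hAm))
      (fun B hBm => mem_subsetsLE.2 (hB B hBm)) neA neB h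
    simp only [Nat.card_Icc, Nat.add_sub_cancel] at this
    omega
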